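/- Let 𝔨 be a finite field with q elements and let K be a separably closed field containing 𝔨 (so K has characteristic p and q is a power of p). Let E be a finite-dimensional K-vector space and let F : E → E be an additive bijection satisfying F(a • x) = a^q • F(x) for all a ∈ K and x ∈ E. Then the fixed-point set E^F = {x ∈ E : F(x) = x} is a 𝔨-submodule of E (for the scalar action of 𝔨 ⊆ K), the natural K-linear map K ⊗_𝔨 E^F → E, a ⊗ x ↦ a • x, is bijective, and in particular dim_𝔨 E^F = dim_K E. -/

import Mathlib

/-!
STATEMENT 0: Let 𝔨 be a finite field with `q` elements and `K` a separably closed field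
containing 𝔨.  Let `E` be a finite-dimensional `K`-vector space and `F : E → E` an additive
bijection satisfying `F (a • x) = a ^ q • F x` for all `a : K`, `x : E`.  Then the fixed-point
set `{x | F x = x}` is a 𝔨-submodule of `E`, the natural `K`-linear map
`K ⊗[𝔨] E^F → E`, `a ⊗ x ↦ a • x`, is bijective, and `dim_𝔨 E^F = dim_K E`.
-/

open scoped TensorProduct

/-- The natural `A`-linear map `A ⊗[R] S → M`, `a ⊗ x ↦ a • x`, for a sub-`R`-module `S` of an
`A`-module `M` (where `R ⊆ A`). -/
noncomputable def baseChangeMap (R A M : Type) [CommRing R] [CommRing A] [Algebra R A]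
    [AddCommGroup M] [Module R M] [Module A M] [IsScalarTower R A M]
    (S : Submodule R M) : A ⊗[R] S →ₗ[A] M :=
  TensorProduct.AlgebraTensorModule.lift
    (LinearMap.toSpanSingleton A (S →ₗ[R] M) S.subtype)

open Polynomial

section SemilinearFrobenius

variable {K : Type*} [Field K] {q : ℕ}

/-- The additive polynomials obtained by eliminating all but the last coordinate from the equation
expressing that a combination of `v, F v, …, F^m v` is fixed by `F`, divided by `X ^ q`. -/
noncomputable def cyclicFixedPoly (q : ℕ) (a : ℕ → K) : ℕ → K[X]
  | 0 => C (a 0)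
  | i + 1 => X ^ (q * (q - 1)) * cyclicFixedPoly q a i ^ q + C (a (i + 1))

theorem derivative_cyclicFixedPoly (hq : (q : K) = 0) (a : ℕ → K) (i : ℕ) :
    derivative (cyclicFixedPoly q a i) = 0 := by
  cases i with
  | zero => simp [cyclicFixedPoly]
  | succ i => simp [cyclicFixedPoly, derivative_pow, hq]

theorem coeff_eq_zero_of_cyclicFixedPoly_eq_zero (hq : 1 < q) (a : ℕ → K) {m : ℕ}
    (h : cyclicFixedPoly q a m = 0) : ∀ i ≤ m, a i = 0 := by
  induction m with
  | zero =>
    intro i hi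
    obtain rfl : i = 0 := by omega
    simpa [cyclicFixedPoly] using h
  | succ m ih =>
    have hpos : q * (q - 1) ≠ 0 := Nat.mul_ne_zero (by omega) (by omega)
    have ha : a (m + 1) = 0 := by
      simpa [cyclicFixedPoly, zero_pow hpos] using congrArg (eval 0) h
    have hm : cyclicFixedPoly q a m = 0 := by
      have : X ^ (q * (q - 1)) * cyclicFixedPoly q a m ^ q = 0 := by
        simpa [cyclicFixedPoly, ha] using h
      exact eq_zero_of_pow_eq_zero
        ((mul_eq_zero.mp this).resolve_left (pow_ne_zero _ X_ne_zero))
    intro i hi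
    rcases Nat.le_succ_iff.mp hi with hi | rfl
    · exact ih hm i hi
    · exact ha

theorem exists_ne_zero_eq_pow_mul_eval_cyclicFixedPoly [IsSepClosed K] (hq : 1 < q)
    (hqK : (q : K) = 0) (a : ℕ → K) (m : ℕ) (ha : ∃ i ≤ m, a i ≠ 0) :
    ∃ t : K, t ≠ 0 ∧ t ^ q * (cyclicFixedPoly q a m).eval t = t := by
  have hH : cyclicFixedPoly q a m ≠ 0 := fun h ↦ by
    obtain ⟨i, hi, hai⟩ := ha
    exact hai (coeff_eq_zero_of_cyclicFixedPoly_eq_zero hq a h i hi)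
  set H := cyclicFixedPoly q a m with hHdef
  have hpow : X * X ^ (q - 1) = (X ^ q : K[X]) := mul_pow_sub_one (by omega) X
  have hsep : (X * (X ^ (q - 1) * H - 1)).Separable := by
    have hd : derivative (X * (X ^ (q - 1) * H - 1)) = -1 := by
      rw [mul_sub, ← mul_assoc, hpow]
      simp [hHdef, derivative_cyclicFixedPoly hqK, derivative_X_pow, hqK]
    rw [separable_def, hd]
    exact isCoprime_one_right.neg_right
  have hdeg : (X ^ (q - 1) * H - 1).degree ≠ 0 := by
    have h0 : 0 < (X ^ (q - 1) * H).degree := by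
      rw [← natDegree_pos_iff_degree_pos, natDegree_mul (pow_ne_zero _ X_ne_zero) hH,
        natDegree_X_pow]
      omega
    rw [degree_sub_eq_left_of_degree_lt (by simpa using h0)]
    exact h0.ne'
  obtain ⟨t, ht⟩ := IsSepClosed.exists_root _ hdeg hsep.of_mul_right
  have ht' : t ^ (q - 1) * H.eval t = 1 := by
    simpa [IsRoot, sub_eq_zero] using ht
  refine ⟨t, ?_, ?_⟩
  · rintro rfl
    simp [zero_pow (show q - 1 ≠ 0 by omega)] at ht'
  · rw [← mul_pow_sub_one (show q ≠ 0 by omega) t, mul_assoc, ht', mul_one]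

variable {E : Type*} [AddCommGroup E] [Module K E] {σ : K →+* K}

theorem exists_iterate_eq_sum_range [FiniteDimensional K E] (f : E → E) (v : E) :
    ∃ (n : ℕ) (a : ℕ → K), f^[n] v = ∑ i ∈ Finset.range n, a i • f^[i] v := by
  let N : ℕ →o Submodule K E :=
    ⟨fun n ↦ Submodule.span K ((fun i ↦ f^[i] v) '' (Finset.range n : Set ℕ)), fun i j hij ↦
      Submodule.span_mono (Set.image_mono (by simpa using hij))⟩
  obtain ⟨n, hn⟩ := monotone_stabilizes_iff_noetherian.mpr (inferInstance : IsNoetherian K E) N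
  have hmem : f^[n] v ∈ N n := by
    rw [hn (n + 1) n.le_succ]
    exact Submodule.subset_span ⟨n, by simp, rfl⟩
  obtain ⟨a, ha⟩ := (Submodule.mem_span_image_finset_iff_exists_fun K).mp hmem
  refine ⟨n, fun i ↦ if h : i ∈ Finset.range n then a ⟨i, h⟩ else 0, ?_⟩
  rw [← ha, ← Finset.sum_coe_sort (Finset.range n)]
  exact Finset.sum_congr rfl fun i _ ↦ by simp only [dif_pos i.2, Subtype.coe_eta]

/-- An injective Frobenius-semilinear map on a nonzero finite-dimensional vector space over a
separably closed field has a nonzero fixed vector. -/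
theorem exists_ne_zero_fixed_of_injective [IsSepClosed K] [FiniteDimensional K E] [Nontrivial E]
    (hq : 1 < q) (hqK : (q : K) = 0) (hσ : ∀ a, σ a = a ^ q) (F : E →ₛₗ[σ] E)
    (hF : Function.Injective F) : ∃ x : E, x ≠ 0 ∧ F x = x := by
  classical
  obtain ⟨v, hv⟩ := exists_ne (0 : E)
  have hex := exists_iterate_eq_sum_range (K := K) F v
  obtain ⟨a, ha⟩ := Nat.find_spec hex
  have hmin := fun k ↦ Nat.find_min (m := k) hex
  obtain ⟨m, hm⟩ : ∃ m, Nat.find hex = m + 1 := by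
    refine Nat.exists_eq_succ_of_ne_zero fun h ↦ hv ?_
    rw [h] at ha
    simpa using ha
  rw [hm] at ha hmin
  have hne : ∃ i ≤ m, a i ≠ 0 := by
    by_contra! h
    rw [Finset.sum_eq_zero fun i hi ↦ by
      rw [h i (Nat.lt_succ_iff.mp (Finset.mem_range.mp hi)), zero_smul]] at ha
    have h0 : F^[m + 1] 0 = 0 := Function.iterate_fixed (map_zero F) _
    exact hv (hF.iterate (m + 1) (ha.trans h0.symm))
  obtain ⟨t, ht, htm⟩ := exists_ne_zero_eq_pow_mul_eval_cyclicFixedPoly hq hqK a m hne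
  set x : ℕ → K := fun i ↦ t ^ q * (cyclicFixedPoly q a i).eval t with hx
  have hx0 : x 0 = t ^ q * a 0 := by simp [hx, cyclicFixedPoly]
  have hxs (i : ℕ) : x (i + 1) = x i ^ q + t ^ q * a (i + 1) := by
    obtain ⟨r, rfl⟩ : ∃ r, q = r + 1 := Nat.exists_eq_succ_of_ne_zero (by omega)
    simp only [hx, cyclicFixedPoly, eval_add, eval_mul, eval_pow, eval_X, eval_C,
      Nat.add_sub_cancel]
    ring
  have hxm : x m = t := htm
  refine ⟨∑ i ∈ Finset.range (m + 1), x i • F^[i] v, fun h ↦ ?_, ?_⟩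
  · refine hmin m m.lt_succ_self ⟨fun i ↦ -(t⁻¹ * x i), ?_⟩
    rw [Finset.sum_range_succ, hxm, add_comm] at h
    have h' := congrArg (t⁻¹ • ·) (eq_neg_of_add_eq_zero_left h)
    simpa [inv_smul_smul₀ ht, Finset.smul_sum, mul_smul] using h'
  · have hFx : F (∑ i ∈ Finset.range (m + 1), x i • F^[i] v)
        = ∑ i ∈ Finset.range (m + 1), x i ^ q • F^[i + 1] v := by
      simp [map_sum, hσ, Function.iterate_succ_apply']
    rw [hFx, Finset.sum_range_succ, hxm, ha, Finset.sum_range_succ' (fun i ↦ a i • F^[i] v),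
      Finset.sum_range_succ' (fun i ↦ x i • F^[i] v), smul_add, ← add_assoc, Finset.smul_sum,
      ← Finset.sum_add_distrib, hx0]
    simp [hxs, add_smul, mul_smul]

/-- A field endomorphism admitting a bijective semilinear map on a nonzero finite-dimensional
space is surjective. -/
theorem surjective_of_bijective_semilinear [FiniteDimensional K E] [Nontrivial E]
    (F : E →ₛₗ[σ] E) (hF : Function.Bijective F) : Function.Surjective σ := by
  have hrank : Module.rank K E = Module.rank σ.fieldRange E :=
    rank_eq_of_equiv_equiv σ.rangeRestrictField (AddEquiv.ofBijective F.toAddMonoidHom hF)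
      ⟨σ.rangeRestrictField.injective, σ.rangeRestrictField_bijective.2⟩
      fun r m ↦ F.map_smulₛₗ r m
  have hfin : Module.finrank K E = Module.finrank σ.fieldRange E :=
    congrArg Cardinal.toNat hrank
  have hmul := Module.finrank_mul_finrank σ.fieldRange K E
  rw [← hfin] at hmul
  have hone : Module.finrank σ.fieldRange K = 1 :=
    Nat.eq_of_mul_eq_mul_right Module.finrank_pos (hmul.trans (one_mul _).symm)
  intro c
  obtain ⟨d, hd⟩ := (finrank_eq_one_iff_of_nonzero' (1 : K) one_ne_zero).mp hone c
  obtain ⟨b, hb⟩ := d.2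
  refine ⟨b, hb.trans ?_⟩
  rw [← hd, Subfield.smul_def, smul_eq_mul, mul_one]

/-- A bijective Frobenius-semilinear map on a finite-dimensional vector space over a separably
closed field has enough fixed vectors to span the space. -/
theorem span_fixed_eq_top_of_bijective [IsSepClosed K] [FiniteDimensional K E]
    (hq : 1 < q) (hqK : (q : K) = 0) (hσ : ∀ a, σ a = a ^ q) (F : E →ₛₗ[σ] E)
    (hF : Function.Bijective F) : Submodule.span K {x | F x = x} = ⊤ := by
  set W := Submodule.span K {x | F x = x}
  by_contra hne
  have hquot : Nontrivial (E ⧸ W) := Submodule.Quotient.nontrivial_iff.mpr hne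
  have : Nontrivial E := (Submodule.mkQ_surjective W).nontrivial
  have hσs : Function.Surjective σ := surjective_of_bijective_semilinear F hF
  have hWF : W ≤ W.comap F := Submodule.span_le.mpr fun x (hx : F x = x) ↦ by
    rw [SetLike.mem_coe, Submodule.mem_comap, hx]
    exact Submodule.subset_span hx
  have hpre : ∀ u ∈ W, ∃ y ∈ W, F y = u := fun u hu ↦ by
    induction hu using Submodule.closure_induction with
    | zero => exact ⟨0, W.zero_mem, map_zero F⟩
    | add x y _ _ hx hy =>
      obtain ⟨x', hx', rfl⟩ := hx
      obtain ⟨y', hy', rfl⟩ := hy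
      exact ⟨x' + y', W.add_mem hx' hy', map_add F _ _⟩
    | smul_mem c x hx =>
      obtain ⟨d, rfl⟩ := hσs c
      exact ⟨d • x, W.smul_mem d (Submodule.subset_span hx), by
        rw [F.map_smulₛₗ, show F x = x from hx]⟩
  have hsolve : ∀ u ∈ W, ∃ y ∈ W, F y - y = u := fun u hu ↦ by
    induction hu using Submodule.closure_induction with
    | zero => exact ⟨0, W.zero_mem, by simp⟩
    | add x y _ _ hx hy =>
      obtain ⟨x', hx', rfl⟩ := hx
      obtain ⟨y', hy', rfl⟩ := hy
      exact ⟨x' + y', W.add_mem hx' hy', by rw [map_add]; abel⟩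
    | smul_mem c x hx =>
      obtain ⟨d, hd⟩ := IsSepClosed.exists_root_C_mul_X_pow_add_C_mul_X_add_C
        1 (-1) (-c) hqK hq (neg_ne_zero.mpr one_ne_zero)
      refine ⟨d • x, W.smul_mem d (Submodule.subset_span hx), ?_⟩
      rw [F.map_smulₛₗ, show F x = x from hx, hσ, ← sub_smul]
      congr 1
      linear_combination hd
  have hinj : Function.Injective (W.mapQ W F hWF) := by
    refine (injective_iff_map_eq_zero _).mpr fun z hz ↦ ?_
    obtain ⟨x, rfl⟩ := W.mkQ_surjective z
    rw [Submodule.mkQ_apply, Submodule.mapQ_apply, Submodule.Quotient.mk_eq_zero] at hz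
    obtain ⟨y, hy, hyx⟩ := hpre _ hz
    rw [Submodule.mkQ_apply, Submodule.Quotient.mk_eq_zero, ← hF.1 hyx]
    exact hy
  obtain ⟨z, hz, hFz⟩ := exists_ne_zero_fixed_of_injective hq hqK hσ _ hinj
  obtain ⟨x, rfl⟩ := W.mkQ_surjective z
  rw [Submodule.mkQ_apply, Submodule.mapQ_apply, Submodule.Quotient.eq] at hFz
  obtain ⟨y, hy, hyx⟩ := hsolve _ hFz
  have hfix : F (x - y) = x - y := by
    rw [map_sub, sub_eq_sub_iff_sub_eq_sub, hyx]
  refine hz ((Submodule.Quotient.mk_eq_zero W).mpr ?_)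
  rw [← sub_add_cancel x y]
  exact W.add_mem (Submodule.subset_span hfix) hy

end SemilinearFrobenius

theorem mem_range_algebraMap_of_pow_card_eq {k K : Type*} [Field k] [Fintype k] [Field K]
    [Algebra k K] {x : K} (hx : x ^ Fintype.card k = x) : x ∈ Set.range (algebraMap k K) := by
  have hs : (X ^ Fintype.card k - X : k[X]).Splits := by
    rw [splits_iff_card_roots, FiniteField.roots_X_pow_card_sub_X,
      FiniteField.X_pow_card_sub_X_natDegree_eq k Fintype.one_lt_card]
    rfl
  have hne := FiniteField.X_pow_card_sub_X_ne_zero K (Fintype.one_lt_card (α := k))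
  have hroots := hs.roots_map (algebraMap k K)
  have hmem : x ∈ ((X ^ Fintype.card k - X : k[X]).map (algebraMap k K)).roots := by
    simp only [Polynomial.map_sub, Polynomial.map_pow, map_X]
    rw [mem_roots hne]
    simp [hx]
  rw [hroots] at hmem
  obtain ⟨y, -, hy⟩ := Multiset.mem_map.mp hmem
  exact ⟨y, hy⟩

/-- Vectors fixed by a Frobenius-semilinear map that are independent over the finite field are
independent over the large field. -/
theorem LinearIndependent.of_fixed_of_semilinear {k K E ι : Type*} [Field k] [Fintype k] [Field K]
    [Algebra k K] [AddCommGroup E] [Module k E] [Module K E] [IsScalarTower k K E] {σ : K →+* K}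
    (hσ : ∀ a, σ a = a ^ Fintype.card k) (F : E →ₛₗ[σ] E) {v : ι → E} (hv : ∀ i, F (v i) = v i)
    (hli : LinearIndependent k v) : LinearIndependent K v := by
  classical
  rw [linearIndependent_iff']
  intro s
  induction s using Finset.induction_on with
  | empty => simp
  | insert j s hj ih =>
    intro g hg
    rw [Finset.sum_insert hj] at hg
    by_cases hgj : g j = 0
    · rw [hgj, zero_smul, zero_add] at hg
      exact Finset.forall_mem_insert _ _ _ |>.mpr ⟨hgj, ih g hg⟩
    exfalso
    have hrel : v j + ∑ i ∈ s, ((g j)⁻¹ * g i) • v i = 0 := by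
      simpa [smul_add, inv_smul_smul₀ hgj, Finset.smul_sum, mul_smul] using
        congrArg ((g j)⁻¹ • ·) hg
    have hrelF : v j + ∑ i ∈ s, σ ((g j)⁻¹ * g i) • v i = 0 := by
      simpa only [map_add, map_sum, F.map_smulₛₗ, hv, map_zero] using congrArg F hrel
    have hdiff := ih (fun i ↦ σ ((g j)⁻¹ * g i) - (g j)⁻¹ * g i) (by
      simp only [sub_smul, Finset.sum_sub_distrib]
      rw [sub_eq_zero]
      exact add_left_cancel (hrelF.trans hrel.symm))
    have hrange (i : ι) : ∃ c : k, i ∈ s → algebraMap k K c = (g j)⁻¹ * g i := by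
      by_cases hi : i ∈ s
      · obtain ⟨c, hc⟩ := mem_range_algebraMap_of_pow_card_eq (k := k)
          ((hσ _).symm.trans (sub_eq_zero.mp (hdiff i hi)))
        exact ⟨c, fun _ ↦ hc⟩
      · exact ⟨0, fun h ↦ absurd h hi⟩
    choose c hc using hrange
    have hk := linearIndependent_iff'.mp hli (insert j s) (Function.update c j 1) (by
      rw [Finset.sum_insert hj, Function.update_self, one_smul, ← hrel]
      congr 1
      refine Finset.sum_congr rfl fun i hi ↦ ?_
      rw [Function.update_of_ne (ne_of_mem_of_not_mem hi hj), ← hc i hi, algebraMap_smul])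
      j (Finset.mem_insert_self j s)
    simp at hk

theorem galois_descent_fixed_points_of_semilinear_frobenius
    (𝔨 : Type) [Field 𝔨] [Fintype 𝔨] (q : ℕ) (hq : Fintype.card 𝔨 = q)
    (K : Type) [Field K] [IsSepClosed K] [Algebra 𝔨 K]
    (E : Type) [AddCommGroup E] [Module 𝔨 E] [Module K E] [IsScalarTower 𝔨 K E]
    [FiniteDimensional K E]
    (F : E → E)
    (hF_add : ∀ x y : E, F (x + y) = F x + F y)
    (hF_bij : Function.Bijective F)
    (hF_semilinear : ∀ (a : K) (x : E), F (a • x) = a ^ q • F x) :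
    ∃ S : Submodule 𝔨 E,
      (S : Set E) = {x : E | F x = x} ∧
      Function.Bijective (baseChangeMap 𝔨 K E S) ∧
      Module.rank 𝔨 S = Module.rank K E := by
  subst hq
  let σ : K →+* K := (FiniteField.frobeniusAlgHom 𝔨 K : K →+* K)
  have hσ (a : K) : σ a = a ^ Fintype.card 𝔨 := rfl
  let f : E →ₛₗ[σ] E :=
    { toFun := F, map_add' := hF_add, map_smul' := hF_semilinear }
  have hqK : ((Fintype.card 𝔨 : ℕ) : K) = 0 := by
    rw [← map_natCast (algebraMap 𝔨 K), FiniteField.cast_card_eq_zero, map_zero]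
  let S : Submodule 𝔨 E :=
    { carrier := {x | F x = x}
      zero_mem' := map_zero f
      add_mem' := fun {x y} (hx : F x = x) (hy : F y = y) ↦
        (hF_add x y).trans (by rw [hx, hy])
      smul_mem' := fun c x (hx : F x = x) ↦ by
        change F (c • x) = c • x
        rw [← algebraMap_smul K c x, hF_semilinear, hx, ← map_pow, FiniteField.pow_card] }
  have hspan : Submodule.span K (S : Set E) = ⊤ :=
    span_fixed_eq_top_of_bijective Fintype.one_lt_card hqK hσ f hF_bij
  let b := Module.Basis.ofVectorSpace 𝔨 S
  have hli : LinearIndependent K fun i ↦ (b i : E) :=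
    LinearIndependent.of_fixed_of_semilinear hσ f (fun i ↦ (b i).2)
      (b.linearIndependent.map' S.subtype S.ker_subtype)
  have hbspan : ⊤ ≤ Submodule.span K (Set.range fun i ↦ (b i : E)) := by
    rw [← hspan, Submodule.span_le]
    intro x hx
    refine Submodule.span_le_restrictScalars 𝔨 K _ ?_
    have hmem := Submodule.mem_map_of_mem (f := S.subtype) (b.mem_span ⟨x, hx⟩)
    rwa [Submodule.map_span, ← Set.range_comp] at hmem
  let B := Module.Basis.mk hli hbspan
  refine ⟨S, rfl, ?_, ?_⟩
  · have hmap : baseChangeMap 𝔨 K E S =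
        ((b.baseChange K).equiv B (Equiv.refl _)).toLinearMap := by
      refine (b.baseChange K).ext fun i ↦ ?_
      rw [LinearEquiv.coe_coe, Module.Basis.equiv_apply]
      simp [baseChangeMap, B]
    rw [hmap]
    exact LinearEquiv.bijective _
  · rw [← b.mk_eq_rank'', ← B.mk_eq_rank'']
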